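/- Let X be a Polish space and let x = (xₙ), y = (yₙ) be injective sequences in X^ℕ. Then the following are equivalent: (i) {xₙ : n ∈ ℕ} ⊆ {yₙ : n ∈ ℕ}; (ii) there exists a sequence (h_m) of permutations of ℕ such that for every k ∈ ℕ the sequence m ↦ h_m⁻¹(k) is eventually constant (i.e., (h_m) is right Cauchy in the group of permutations of ℕ) and h_m·y converges pointwise to x, where (g·y)ₙ = y_{g⁻¹(n)} denotes the coordinate-permutation action. -/

import Mathlib

open Filter Set Topology

lemma exists_perm_agree (f : ℕ → ℕ) (hf : Function.Injective f) (m : ℕ) :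
    ∃ g : Equiv.Perm ℕ, ∀ k < m, g k = f k := by
  induction m with
  | zero => exact ⟨1, by simp⟩
  | succ m ih =>
    obtain ⟨g, hg⟩ := ih
    refine ⟨Equiv.swap (g m) (f m) * g, fun k hk => ?_⟩
    rw [Equiv.Perm.mul_apply]
    rcases Nat.lt_succ_iff_lt_or_eq.mp hk with h | h
    · rw [Equiv.swap_apply_of_ne_of_ne, hg k h]
      · exact fun e => h.ne (g.injective e)
      · rw [hg k h]
        exact fun e => h.ne (hf e)
    · subst h
      exact Equiv.swap_apply_left _ _

/-- For injective sequences `x, y` in a Polish space, `range x ⊆ range y` iff there is a right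
Cauchy sequence `(h m)` of permutations of `ℕ` (i.e., `m ↦ (h m)⁻¹ k` is eventually constant
for each `k`) with `h m • y → x` pointwise, where `(g • y) n = y (g⁻¹ n)`. -/
theorem range_subset_iff_perm_rightCauchy_tendsto
    (X : Type) [TopologicalSpace X] [PolishSpace X]
    (x y : ℕ → X) (hx : Function.Injective x) (hy : Function.Injective y) :
    Set.range x ⊆ Set.range y ↔
      ∃ h : ℕ → Equiv.Perm ℕ,
        (∀ k : ℕ, ∃ (N : ℕ) (c : ℕ), ∀ m ≥ N, (h m)⁻¹ k = c) ∧
        (∀ n : ℕ, Filter.Tendsto (fun m => y ((h m)⁻¹ n)) Filter.atTop (𝓝 (x n))) := by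
  constructor
  · intro hsub
    have hex : ∀ n, ∃ j, y j = x n := fun n => hsub ⟨n, rfl⟩
    choose f hf using hex
    have hinj : Function.Injective f := fun a b e => hx (by rw [← hf a, ← hf b, e])
    choose g hg using exists_perm_agree f hinj
    refine ⟨fun m => (g m)⁻¹, fun k => ⟨k + 1, f k, fun m hm => ?_⟩, fun n => ?_⟩
    · rw [inv_inv]
      exact hg m k hm
    · refine tendsto_const_nhds.congr' ?_
      filter_upwards [eventually_ge_atTop (n + 1)] with m hm
      rw [inv_inv, hg m n hm, hf]
  · rintro ⟨h, hc, ht⟩ _ ⟨n, rfl⟩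
    obtain ⟨N, c, hN⟩ := hc n
    refine ⟨c, tendsto_nhds_unique (tendsto_const_nhds.congr' ?_) (ht n)⟩
    filter_upwards [eventually_ge_atTop N] with m hm
    rw [hN m hm]
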